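/- arXiv:math/0007163 — 2 statements merged into one kernel-verified Lean document; each statement's English description precedes it below -/
import Mathlib

section
/- The function f(τ) = (η(τ)η(2τ))^{-8} is a modular form of weight -8 for Γ₀(2): for every matrix (a b; c d) ∈ SL₂(ℤ) with c ≡ 0 mod 2, f((aτ+b)/(cτ+d)) = (cτ+d)^{-8} f(τ). -/
/-- The Dedekind eta function. -/
noncomputable def dedekindEta (t : ℂ) : ℂ :=
  Complex.exp (Real.pi * Complex.I * t / 12) *
    ∏' n : ℕ, (1 - Complex.exp (2 * Real.pi * Complex.I * (n + 1) * t))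

/-- `f = (η(τ)η(2τ))^{-8}`. -/
noncomputable def fEta2 (t : ℂ) : ℂ := (dedekindEta t * dedekindEta (2 * t)) ^ (-8 : ℤ)

/-- `g₀(τ) = (f(τ/2)+f((τ+1)/2))/2`. -/
noncomputable def gZero (t : ℂ) : ℂ := (fEta2 (t / 2) + fEta2 ((t + 1) / 2)) / 2

/-- `g₁(τ) = (f(τ/2)-f((τ+1)/2))/2`. -/
noncomputable def gOne (t : ℂ) : ℂ := (fEta2 (t / 2) - fEta2 ((t + 1) / 2)) / 2

theorem dedekindEta_eq_eta (t : ℂ) : dedekindEta t = ModularForm.eta t := by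
  simp only [dedekindEta, ModularForm.eta, ModularForm.eta_q_eq_cexp, Function.Periodic.qParam]
  congr 2
  push_cast
  ring

theorem dedekindEta_add_one (t : ℂ) :
    dedekindEta (t + 1) = Complex.exp (Real.pi * Complex.I / 12) * dedekindEta t := by
  have h (n : ℕ) : Complex.exp (2 * Real.pi * Complex.I * (n + 1) * (t + 1)) =
      Complex.exp (2 * Real.pi * Complex.I * (n + 1) * t) := by
    rw [Complex.exp_eq_exp_iff_exists_int]
    exact ⟨n + 1, by push_cast; ring⟩
  simp only [dedekindEta, h]
  rw [← mul_assoc, ← Complex.exp_add]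
  ring_nf

theorem Complex.sqrt_pow_eight {z : ℂ} (hz : z ≠ 0) : Complex.sqrt z ^ 8 = z ^ 4 := by
  rw [_root_.sqrt_eq_exp hz, ← Complex.exp_nat_mul,
    show ((8 : ℕ) : ℂ) * (Complex.log z / 2) = (4 : ℕ) * Complex.log z by push_cast; ring,
    Complex.exp_nat_mul, Complex.exp_log hz]

theorem dedekindEta_neg_inv_pow_eight {t : ℂ} (ht : 0 < t.im) :
    dedekindEta (-1 / t) ^ 8 = t ^ 4 * dedekindEta t ^ 8 := by
  have h0 : t ≠ 0 := by rintro rfl; simp at ht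
  have h : ModularForm.eta (-1 / t) =
      (Complex.sqrt Complex.I)⁻¹ * (Complex.sqrt t * ModularForm.eta t) := by
    simpa using ModularForm.eta_comp_eq_csqrt_I_inv (x := t) ht
  rw [dedekindEta_eq_eta, dedekindEta_eq_eta, h, mul_pow, mul_pow, inv_pow,
    Complex.sqrt_pow_eight h0, Complex.sqrt_pow_eight Complex.I_ne_zero, Complex.I_pow_four]
  simp

theorem fEta2_eq_inv (t : ℂ) :
    fEta2 t = (dedekindEta t ^ 8 * dedekindEta (2 * t) ^ 8)⁻¹ := by
  rw [fEta2, ← mul_pow, zpow_neg]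
  norm_cast

theorem fEta2_periodic : Function.Periodic fEta2 1 := by
  intro t
  have h : Complex.exp (Real.pi * Complex.I / 12) ^ 24 = 1 := by
    rw [← Complex.exp_nat_mul, ← Complex.exp_two_pi_mul_I]
    congr 1
    push_cast
    ring
  rw [fEta2_eq_inv, fEta2_eq_inv, show 2 * (t + 1) = 2 * t + 1 + 1 by ring,
    dedekindEta_add_one, dedekindEta_add_one, dedekindEta_add_one]
  congr 1
  linear_combination dedekindEta t ^ 8 * dedekindEta (2 * t) ^ 8 * h

theorem fEta2_fricke {t : ℂ} (ht : 0 < t.im) :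
    fEta2 (-1 / (2 * t)) = (16 * t ^ 8)⁻¹ * fEta2 t := by
  have h0 : t ≠ 0 := by rintro rfl; simp at ht
  rw [fEta2_eq_inv, fEta2_eq_inv, show 2 * (-1 / (2 * t)) = -1 / t by field_simp,
    dedekindEta_neg_inv_pow_eight ht, dedekindEta_neg_inv_pow_eight (by simpa using ht),
    ← mul_inv]
  congr 1
  ring

theorem Complex.two_mul_intCast_mul_add_one_ne_zero {t : ℂ} (ht : 0 < t.im) (n : ℤ) :
    2 * n * t + 1 ≠ 0 := by
  intro h
  have him := congrArg Complex.im h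
  simp at him
  rcases him with rfl | him
  · simp at h
  · exact ht.ne' him

theorem Complex.im_div_two_mul_intCast_mul_add_one_pos {t : ℂ} (ht : 0 < t.im) (n : ℤ) :
    0 < (t / (2 * n * t + 1)).im := by
  have hN := Complex.normSq_pos.mpr (Complex.two_mul_intCast_mul_add_one_ne_zero ht n)
  have : (t / (2 * n * t + 1)).im = t.im / Complex.normSq (2 * n * t + 1) := by
    rw [Complex.div_im, ← sub_div]
    congr 1
    simp
    ring
  rw [this]
  positivity

theorem fEta2_div_two_mul_add_one {t : ℂ} (ht : 0 < t.im) :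
    fEta2 (t / (2 * t + 1)) = (2 * t + 1) ^ (-8 : ℤ) * fEta2 t := by
  have h0 : t ≠ 0 := by rintro rfl; simp at ht
  have h1 : 2 * t + 1 ≠ 0 := by
    simpa using Complex.two_mul_intCast_mul_add_one_ne_zero ht 1
  have him : 0 < (t / (2 * t + 1)).im := by
    simpa using Complex.im_div_two_mul_intCast_mul_add_one_pos ht 1
  have h := fEta2_fricke him
  rw [show -1 / (2 * (t / (2 * t + 1))) = -1 / (2 * t) - 1 by field_simp; ring,
    fEta2_periodic.sub_eq, fEta2_fricke ht] at h
  rw [show (2 * t + 1) ^ (-8 : ℤ) = ((2 * t + 1) ^ 8)⁻¹ by rw [zpow_neg]; norm_cast]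
  field_simp at h
  rw [h, mul_comm t 2, inv_mul_cancel_left₀ (pow_ne_zero 8 h1)]

theorem fEta2_div_neg_two_mul_add_one {t : ℂ} (ht : 0 < t.im) :
    fEta2 (t / (-2 * t + 1)) = (-2 * t + 1) ^ (-8 : ℤ) * fEta2 t := by
  have h1 : -2 * t + 1 ≠ 0 := by
    simpa using Complex.two_mul_intCast_mul_add_one_ne_zero ht (-1)
  have him : 0 < (t / (-2 * t + 1)).im := by
    simpa using Complex.im_div_two_mul_intCast_mul_add_one_pos ht (-1)
  have h := fEta2_div_two_mul_add_one him
  have h2 : 2 * (t / (-2 * t + 1)) + 1 = (-2 * t + 1)⁻¹ := by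
    refine eq_inv_of_mul_eq_one_left ?_
    rw [add_mul, mul_assoc, div_mul_cancel₀ _ h1]
    ring
  rw [h2, div_inv_eq_mul, div_mul_cancel₀ _ h1, inv_zpow] at h
  rw [h, mul_inv_cancel_left₀ (zpow_ne_zero _ h1)]

/-- Weight `-8` covariance of `fEta2` under the Möbius transformation with coefficients
`a, b, c, d`. -/
def FEta2Covariant (a b c d : ℤ) : Prop :=
  ∀ τ : ℂ, 0 < τ.im → fEta2 ((a * τ + b) / (c * τ + d)) = (c * τ + d) ^ (-8 : ℤ) * fEta2 τ

theorem FEta2Covariant.of_translate {a b c d ε : ℤ}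
    (h : FEta2Covariant a (b - ε * a) c (d - ε * c)) : FEta2Covariant a b c d := by
  intro τ hτ
  have h' := h (τ + ε) (by simpa using hτ)
  have hp : fEta2 (τ + ε) = fEta2 τ := by simpa using fEta2_periodic.int_mul ε τ
  rw [hp] at h'
  push_cast at h'
  convert h' using 2 <;> ring_nf

theorem FEta2Covariant.of_shear {a b c d ε : ℤ} (hε : ε = 1 ∨ ε = -1)
    (h : FEta2Covariant (a - 2 * ε * b) b (c - 2 * ε * d) d) : FEta2Covariant a b c d := by
  intro τ hτ
  have h1 := Complex.two_mul_intCast_mul_add_one_ne_zero hτ ε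
  have h' := h _ (Complex.im_div_two_mul_intCast_mul_add_one_pos hτ ε)
  have hv : fEta2 (τ / (2 * ε * τ + 1)) = (2 * ε * τ + 1) ^ (-8 : ℤ) * fEta2 τ := by
    rcases hε with rfl | rfl
    · simpa using fEta2_div_two_mul_add_one hτ
    · simpa using fEta2_div_neg_two_mul_add_one hτ
  have hden (x y : ℤ) : ((x - 2 * ε * y : ℤ) : ℂ) * (τ / (2 * ε * τ + 1)) + y =
      (x * τ + y) / (2 * ε * τ + 1) := by
    push_cast
    field_simp
    ring
  rw [hv, hden, hden, div_div_div_cancel_right₀ h1, ← mul_assoc, ← mul_zpow,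
    div_mul_cancel₀ _ h1] at h'
  exact h'

theorem fEta2Covariant_of_two_dvd (a b c d : ℤ) (hdet : a * d - b * c = 1) (hc : 2 ∣ c) :
    FEta2Covariant a b c d := by
  induction hn : c.natAbs + d.natAbs using Nat.strong_induction_on generalizing a b c d with
  | _ n ih =>
  subst hn
  have hd : ¬ 2 ∣ d := by
    intro hd
    have : (2 : ℤ) ∣ 1 := hdet ▸ dvd_sub (hd.mul_left a) (hc.mul_left b)
    omega
  by_cases h0 : c = 0
  · subst h0
    intro τ _
    have hp (n : ℤ) : fEta2 (τ + n) = fEta2 τ := by simpa using fEta2_periodic.int_mul n τ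
    rcases Int.eq_one_or_neg_one_of_mul_eq_one' (u := a) (v := d) (by simpa using hdet) with
      ⟨rfl, rfl⟩ | ⟨rfl, rfl⟩
    · simpa using hp b
    · have := hp (-b)
      rw [← this]
      norm_num [zpow_neg, neg_add_eq_sub, div_neg]
      ring_nf
  · rcases lt_or_ge c.natAbs d.natAbs with hlt | hge
    · obtain ⟨ε, hε⟩ : ∃ ε : ℤ, (d - ε * c).natAbs < d.natAbs := by
        by_cases hs : (d - c).natAbs < d.natAbs
        · exact ⟨1, by simpa using hs⟩
        · exact ⟨-1, by omega⟩
      exact .of_translate (ε := ε) (ih _ (by omega) _ _ _ _ (by linear_combination hdet) hc rfl)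
    · obtain ⟨ε, hε1, hε⟩ : ∃ ε : ℤ, (ε = 1 ∨ ε = -1) ∧ (c - 2 * ε * d).natAbs < c.natAbs := by
        by_cases hs : (c - 2 * d).natAbs < c.natAbs
        · exact ⟨1, .inl rfl, by simpa using hs⟩
        · exact ⟨-1, .inr rfl, by omega⟩
      exact .of_shear hε1 (ih _ (by omega) _ _ _ _ (by linear_combination hdet)
        (dvd_sub hc ⟨ε * d, by ring⟩) rfl)

theorem stmt5 (a b c d : ℤ) (hdet : a * d - b * c = 1) (hc : 2 ∣ c)
    (τ : ℂ) (hτ : 0 < τ.im) :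
    fEta2 ((a * τ + b) / (c * τ + d)) = (c * τ + d) ^ (-8 : ℤ) * fEta2 τ := by
  exact fEta2Covariant_of_two_dvd a b c d hdet hc τ hτ
end

section
/- Let δ(τ) = f(τ) + γ(τ) where f(τ) = 2·η(6τ)²η(2τ)²/(η(3τ)⁴η(τ)⁴) and γ(τ) = η(3τ/2)²η(τ/2)²/(η(3τ)⁴η(τ)⁴). Then the expansion of δ in powers of q^{1/2} contains only half-integral powers of q: δ(τ) = q^{-1/2} + 3q^{1/2} + 15q^{3/2} + 43q^{5/2} + ⋯, i.e., all coefficients of integral powers q^n (n ∈ ℤ) vanish. -/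
/-- `f(τ) = 2·η(6τ)²η(2τ)²/(η(3τ)⁴η(τ)⁴)`. -/
noncomputable def fSuper3 (t : ℂ) : ℂ :=
  2 * dedekindEta (6 * t) ^ 2 * dedekindEta (2 * t) ^ 2 /
    (dedekindEta (3 * t) ^ 4 * dedekindEta t ^ 4)

/-- `γ(τ) = η(3τ/2)²η(τ/2)²/(η(3τ)⁴η(τ)⁴)`. -/
noncomputable def gammaSuper3 (t : ℂ) : ℂ :=
  dedekindEta (3 * t / 2) ^ 2 * dedekindEta (t / 2) ^ 2 /
    (dedekindEta (3 * t) ^ 4 * dedekindEta t ^ 4)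

open Complex Filter Topology

/-- Cauchy's estimate for the coefficients of a Laurent series on a circle. -/
theorem norm_laurentCoeff_mul_zpow_le {c : ℤ → ℂ} {g : ℂ → ℂ} {r M : ℝ} (hr : 0 < r)
    (hg : ∀ x : ℂ, ‖x‖ = r → HasSum (fun k : ℤ ↦ c k * x ^ k) (g x))
    (hM : ∀ x : ℂ, ‖x‖ = r → ‖g x‖ ≤ M) (j : ℤ) : ‖c j‖ * r ^ j ≤ M := by
  have hcm : ∀ θ : ℝ, circleMap 0 r θ ≠ 0 := fun θ ↦ circleMap_ne_center hr.ne'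
  have hnorm : ∀ θ : ℝ, ‖circleMap 0 r θ‖ = r := fun θ ↦ by simp [abs_of_pos hr]
  have hs := (hg r (by simp [abs_of_pos hr])).summable.norm
  have key : HasSum (fun k : ℤ ↦ ∮ z in C(0, r), c k * (z - 0) ^ (k - j - 1))
      (∮ z in C(0, r), g z * z ^ (-j - 1)) := by
    unfold circleIntegral
    refine intervalIntegral.hasSum_integral_of_dominated_convergence
      (fun k _ ↦ ‖c k * (r : ℂ) ^ k‖ * r ^ (-j)) (fun k ↦ ?_) (fun k ↦ ?_) ?_ ?_ ?_
    · refine Continuous.aestronglyMeasurable ?_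
      simp only [deriv_circleMap, sub_zero, smul_eq_mul]
      exact ((continuous_circleMap 0 r).mul continuous_const).mul (continuous_const.mul
        ((continuous_circleMap 0 r).zpow₀ _ fun θ ↦ Or.inl (hcm θ)))
    · refine .of_forall fun θ _ ↦ le_of_eq ?_
      simp only [deriv_circleMap, sub_zero, smul_eq_mul, norm_mul, norm_zpow, hnorm, norm_I,
        mul_one, Complex.norm_real, Real.norm_eq_abs, abs_of_pos hr]
      rw [show k - j - 1 = k + -j - 1 by ring, zpow_sub_one₀ hr.ne', zpow_add₀ hr.ne']
      field_simp
    · exact .of_forall fun θ _ ↦ hs.mul_right _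
    · exact intervalIntegrable_const
    · refine .of_forall fun θ _ ↦ ?_
      have := ((hg _ (hnorm θ)).mul_right (circleMap 0 r θ ^ (-j - 1))).mul_left
        (deriv (circleMap 0 r) θ)
      refine this.congr_fun ?_
      intro k
      simp only [sub_zero, smul_eq_mul]
      rw [mul_assoc (c k), ← zpow_add₀ (hcm θ)]
      ring_nf
  have hval : ∀ k : ℤ, k ≠ j → (∮ z in C(0, r), c k * (z - 0) ^ (k - j - 1)) = 0 := fun k hk ↦ by
    rw [circleIntegral.integral_const_mul, circleIntegral.integral_sub_zpow_of_ne (by grind),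
      mul_zero]
  have h1 := key.unique (hasSum_single j hval)
  have h2 : (∮ z in C(0, r), c j * (z - 0) ^ (j - j - 1)) = c j * (2 * Real.pi * I) := by
    rw [circleIntegral.integral_const_mul]
    simp only [sub_self, zero_sub, zpow_neg_one]
    rw [circleIntegral.integral_sub_center_inv (0 : ℂ) hr.ne']
  have h3 := circleIntegral.norm_integral_le_of_norm_le_const (C := M * r ^ (-j - 1)) hr.le
    (f := fun z ↦ g z * z ^ (-j - 1)) (c := 0) fun z hz ↦ by
      have hz : ‖z‖ = r := by simpa using hz
      rw [norm_mul, norm_zpow, hz]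
      exact mul_le_mul_of_nonneg_right (hM z hz) (by positivity)
  rw [h1, h2] at h3
  rw [zpow_sub_one₀ hr.ne', zpow_neg] at h3
  have hp := Real.pi_pos
  simp only [norm_mul, Complex.norm_real, Real.norm_eq_abs, abs_of_pos hp, norm_I, mul_one,
    Complex.norm_ofNat] at h3
  have hrj : 0 < r ^ j := by positivity
  have h4 : ‖c j‖ * (2 * Real.pi) * r ^ j ≤ 2 * Real.pi * r * (M * ((r ^ j)⁻¹ * r⁻¹)) * r ^ j :=
    mul_le_mul_of_nonneg_right h3 hrj.le
  rw [show 2 * Real.pi * r * (M * ((r ^ j)⁻¹ * r⁻¹)) * r ^ j = M * (2 * Real.pi) by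
    field_simp] at h4
  nlinarith

theorem laurentCoeff_eq_zero {c : ℤ → ℂ} {g : ℂ → ℂ} {ε C : ℝ} {N : ℕ} (hε : 0 < ε)
    (hg : ∀ x : ℂ, 0 < ‖x‖ → ‖x‖ < ε → HasSum (fun k : ℤ ↦ c k * x ^ k) (g x))
    (hC : ∀ x : ℂ, 0 < ‖x‖ → ‖x‖ < ε → ‖g x‖ ≤ C * ‖x‖ ^ N) {j : ℤ} (hj : j < N) : c j = 0 := by
  have hlim : Tendsto (fun r : ℝ ↦ C * r ^ (N - j : ℤ).toNat) (𝓝[>] 0) (𝓝 0) := by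
    have : Continuous (fun r : ℝ ↦ C * r ^ (N - j : ℤ).toNat) := by fun_prop
    refine tendsto_nhdsWithin_of_tendsto_nhds ?_
    convert this.tendsto 0 using 2
    rw [zero_pow (by omega), mul_zero]
  have hle : ∀ᶠ r : ℝ in 𝓝[>] 0, ‖c j‖ ≤ C * r ^ (N - j : ℤ).toNat := by
    filter_upwards [Ioo_mem_nhdsGT hε] with r hr
    have h := norm_laurentCoeff_mul_zpow_le (c := c) (g := g) (M := C * r ^ N) hr.1
      (fun x hx ↦ hg x (hx ▸ hr.1) (hx ▸ hr.2))
      (fun x hx ↦ by simpa [hx] using hC x (hx ▸ hr.1) (hx ▸ hr.2)) j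
    have hr0 := hr.1
    rw [← le_div_iff₀ (by positivity)] at h
    refine h.trans_eq ?_
    rw [mul_div_assoc, ← zpow_natCast, ← zpow_natCast, ← zpow_sub₀ hr.1.ne',
      Int.toNat_of_nonneg (by omega)]
  exact norm_le_zero_iff.mp (ge_of_tendsto hlim hle)

/-- Euler's product `∏ (1 - x ^ n)` over `n ≥ 1`. -/
noncomputable def eulerProd (x : ℂ) : ℂ := ∏' n : ℕ, (1 - x ^ (n + 1))

/-- The partial products of `eulerProd`. -/
noncomputable def eulerPartial (x : ℂ) (n : ℕ) : ℂ := ∏ k ∈ Finset.range n, (1 - x ^ (k + 1))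

theorem tendsto_eulerPartial {x : ℂ} (hx : ‖x‖ < 1) :
    Tendsto (eulerPartial x) atTop (𝓝 (eulerProd x)) :=
  (ModularForm.multipliable_one_sub_pow hx).hasProd.tendsto_prod_nat

theorem one_sub_pow_ne_zero {x : ℂ} (hx : ‖x‖ < 1) {n : ℕ} (hn : n ≠ 0) : 1 - x ^ n ≠ 0 := by
  intro h
  have : ‖x ^ n‖ < 1 := by rw [norm_pow]; exact pow_lt_one₀ (norm_nonneg _) hx hn
  rw [← sub_eq_zero.mp h, norm_one] at this
  exact lt_irrefl _ this

theorem one_add_pow_ne_zero {x : ℂ} (hx : ‖x‖ < 1) {n : ℕ} (hn : n ≠ 0) : 1 + x ^ n ≠ 0 := by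
  intro h
  refine one_sub_pow_ne_zero hx (n := 2 * n) (by omega) ?_
  rw [mul_comm 2 n, pow_mul]
  linear_combination (1 - x ^ n) * h

theorem eulerProd_ne_zero {x : ℂ} (hx : ‖x‖ < 1) : eulerProd x ≠ 0 := by
  simp only [eulerProd, sub_eq_add_neg]
  refine tprod_one_add_ne_zero_of_summable (fun i ↦ ?_) ?_
  · rw [← sub_eq_add_neg]; exact one_sub_pow_ne_zero hx (by omega)
  · simpa using (summable_nat_add_iff 1).mpr (summable_geometric_of_lt_one (norm_nonneg _) hx)

theorem eulerPartial_ne_zero {x : ℂ} (hx : ‖x‖ < 1) (n : ℕ) : eulerPartial x n ≠ 0 :=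
  Finset.prod_ne_zero_iff.mpr fun _ _ ↦ one_sub_pow_ne_zero hx (by omega)

theorem eulerPartial_succ (x : ℂ) (n : ℕ) :
    eulerPartial x (n + 1) = eulerPartial x n * (1 - x ^ (n + 1)) :=
  Finset.prod_range_succ _ _

theorem eulerPartial_add (x : ℂ) (m n : ℕ) : eulerPartial x (m + n) =
    eulerPartial x m * ∏ k ∈ Finset.range n, (1 - x ^ (m + k + 1)) :=
  Finset.prod_range_add _ _ _

theorem norm_sq_lt_one {x : ℂ} (hx : ‖x‖ < 1) : ‖x ^ 2‖ < 1 := by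
  rw [norm_pow]; exact pow_lt_one₀ (norm_nonneg _) hx (by norm_num)

theorem norm_eulerProd_sub_eulerPartial_le {x : ℂ} (hx : ‖x‖ ≤ 1 / 2) (m : ℕ) :
    ‖eulerProd x - eulerPartial x m‖ ≤ 4 * ‖eulerPartial x m‖ * ‖x‖ ^ (m + 1) := by
  have hx1 : ‖x‖ < 1 := by linarith
  have hlim : Tendsto (fun n ↦ eulerPartial x (m + n)) atTop (𝓝 (eulerProd x)) := by
    simpa only [add_comm m] using (tendsto_add_atTop_iff_nat m).mpr (tendsto_eulerPartial hx1)
  refine le_of_tendsto (hlim.sub_const _).norm (.of_forall fun n ↦ ?_)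
  rw [eulerPartial_add, ← mul_sub_one, norm_mul, mul_assoc, mul_left_comm]
  refine mul_le_mul_of_nonneg_left ?_ (norm_nonneg _)
  have h1 := (Finset.range n).norm_prod_one_add_sub_one_le (fun k ↦ -x ^ (m + k + 1))
  simp only [← sub_eq_add_neg, norm_neg, norm_pow] at h1
  refine h1.trans ?_
  have h2 : ∑ k ∈ Finset.range n, ‖x‖ ^ (m + k + 1) ≤ 2 * ‖x‖ ^ (m + 1) := by
    have : ∑ k ∈ Finset.range n, ‖x‖ ^ k ≤ 2 := by
      refine ((summable_geometric_of_lt_one (norm_nonneg x) hx1).sum_le_tsum _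
        (fun _ _ ↦ by positivity)).trans ?_
      rw [tsum_geometric_of_lt_one (norm_nonneg x) hx1, inv_le_comm₀ (by linarith) (by norm_num)]
      linarith
    calc _ = ‖x‖ ^ (m + 1) * ∑ k ∈ Finset.range n, ‖x‖ ^ k := by
          rw [Finset.mul_sum]; exact Finset.sum_congr rfl fun k _ ↦ by ring
      _ ≤ ‖x‖ ^ (m + 1) * 2 := by gcongr
      _ = _ := mul_comm _ _
  have h3 : ‖x‖ ^ (m + 1) ≤ 1 / 2 :=
    (pow_le_of_le_one (norm_nonneg _) hx1.le (by omega)).trans hx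
  have h4 : 0 ≤ ‖x‖ ^ (m + 1) := by positivity
  have h5 := Real.abs_exp_sub_one_le (x := 2 * ‖x‖ ^ (m + 1))
    (by rw [abs_le]; constructor <;> linarith)
  rw [abs_of_nonneg (by positivity : 0 ≤ 2 * ‖x‖ ^ (m + 1))] at h5
  have h6 := (le_abs_self _).trans h5
  have h7 := Real.exp_le_exp.mpr h2
  linarith

/-- If `p n → p₀ ≠ 0`, the terms with `s ≥ 1` in Shanks' finite sums are negligible. -/
theorem tendsto_shanksSum {x p₀ : ℂ} (hx : ‖x‖ < 1) {p c : ℕ → ℂ} {a : ℕ → ℕ → ℕ}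
    (hp : Tendsto p atTop (𝓝 p₀)) (hp₀ : p₀ ≠ 0) (hp0 : p 0 = 1) (hc0 : c 0 = 1)
    (ha0 : ∀ n, a n 0 = 0) (ha : ∀ n s, s ≠ 0 → n ≤ a n s) (hc : ∃ C, ∀ s, ‖c s‖ ≤ C) :
    Tendsto (fun n ↦ ∑ s ∈ Finset.range (n + 1), c s * (p n / p s) * x ^ a n s) atTop (𝓝 p₀) := by
  obtain ⟨C, hC⟩ := hc
  obtain ⟨A, hA⟩ := isBounded_iff_forall_norm_le.mp (Metric.isBounded_range_of_tendsto _ hp)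
  obtain ⟨B, hB⟩ := isBounded_iff_forall_norm_le.mp
    (Metric.isBounded_range_of_tendsto _ (hp.inv₀ hp₀))
  replace hA : ∀ n, ‖p n‖ ≤ A := fun n ↦ hA _ ⟨n, rfl⟩
  replace hB : ∀ n, ‖(p n)⁻¹‖ ≤ B := fun n ↦ hB _ ⟨n, rfl⟩
  have hA0 := (norm_nonneg _).trans (hA 0)
  have hB0 := (norm_nonneg _).trans (hB 0)
  have hC0 := (norm_nonneg _).trans (hC 0)
  have hdiff : Tendsto (fun n ↦ ∑ s ∈ Finset.range n, c (s + 1) * (p n / p (s + 1)) *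
      x ^ a n (s + 1)) atTop (𝓝 0) := by
    have hb : Tendsto (fun n : ℕ ↦ C * (A * B) * (n * ‖x‖ ^ n)) atTop (𝓝 0) := by
      simpa using (tendsto_self_mul_const_pow_of_lt_one (norm_nonneg x) hx).const_mul (C * (A * B))
    refine squeeze_zero_norm (fun n ↦ ?_) hb
    refine (norm_sum_le_of_le _ (f := fun s ↦ c (s + 1) * (p n / p (s + 1)) *
      x ^ a n (s + 1)) (n := fun _ ↦ C * (A * B) * ‖x‖ ^ n) fun s _ ↦ ?_).trans_eq ?_
    · rw [norm_mul, norm_mul, div_eq_mul_inv, norm_mul, norm_pow]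
      have hpow := pow_le_pow_of_le_one (norm_nonneg x) hx.le (ha n (s + 1) (by omega))
      exact mul_le_mul (mul_le_mul (hC _) (mul_le_mul (hA _) (hB _) (norm_nonneg _) hA0)
        (by positivity) hC0) hpow (by positivity) (by positivity)
    · simp; ring
  have := hdiff.add hp
  rw [zero_add] at this
  refine this.congr fun n ↦ ?_
  rw [Finset.sum_range_succ', hc0, hp0, ha0]
  simp

theorem norm_one_add_inv_le {x : ℂ} (hx : ‖x‖ < 1) : ∃ C, ∀ s : ℕ, ‖2 / (1 + x ^ s)‖ ≤ C := by
  refine ⟨1 + 2 / (1 - ‖x‖), fun s ↦ ?_⟩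
  have h0 : 0 < 1 - ‖x‖ := by linarith
  rcases eq_or_ne s 0 with rfl | hs
  · norm_num; positivity
  · have h1 : 1 - ‖x‖ ≤ ‖1 + x ^ s‖ := by
      have := norm_sub_norm_le 1 (-x ^ s)
      rw [norm_neg, norm_one, sub_neg_eq_add, norm_pow] at this
      linarith [pow_le_of_le_one (norm_nonneg x) hx.le hs]
    rw [norm_div, Complex.norm_ofNat]
    have : 2 / ‖1 + x ^ s‖ ≤ 2 / (1 - ‖x‖) := by gcongr
    linarith

theorem shanks_square_sum {x : ℂ} {p : ℕ → ℂ} (hx : ‖x‖ < 1) (hp : ∀ n, p n ≠ 0) (hp0 : p 0 = 1)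
    (hps : ∀ n, p (n + 1) * (1 + x ^ (n + 1)) = p n * (1 - x ^ (n + 1))) (n : ℕ) :
    ∑ s ∈ Finset.range (n + 1), (2 / (1 + x ^ s)) * (p n / p s) * ((-1) ^ s * x ^ (s * (n + 1))) =
      1 + 2 * ∑ s ∈ Finset.range n, (-1) ^ (s + 1) * x ^ ((s + 1) ^ 2) := by
  induction n with
  | zero => simp [hp0]; norm_num
  | succ n ih =>
    have hn := one_add_pow_ne_zero hx (n := n + 1) (by omega)
    have hn' := one_sub_pow_ne_zero hx (n := n + 1) (by omega)
    have htel : ∀ m, ∑ s ∈ Finset.range m,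
        ((2 / (1 + x ^ s)) * (p (n + 1) / p s) * ((-1) ^ s * x ^ (s * (n + 1 + 1))) -
         (2 / (1 + x ^ s)) * (p n / p s) * ((-1) ^ s * x ^ (s * (n + 1)))) =
        2 * (-1) ^ m * (p n / p m) * (1 - x ^ m) / (1 + x ^ m) * x ^ (m * (n + 1)) /
          (1 + x ^ (n + 1)) := by
      intro m
      induction m with
      | zero => simp
      | succ m ihm =>
        rw [Finset.sum_range_succ, ihm]
        have hm : 1 + x ^ m ≠ 0 := by
          rcases eq_or_ne m 0 with rfl | h
          · norm_num
          · exact one_add_pow_ne_zero hx h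
        have hm1 := one_add_pow_ne_zero hx (n := m + 1) (by omega)
        have hm1' := one_sub_pow_ne_zero hx (n := m + 1) (by omega)
        have e1 : p (n + 1) = p n * (1 - x ^ (n + 1)) / (1 + x ^ (n + 1)) := by
          rw [eq_div_iff hn, hps]
        have e2 : p (m + 1) = p m * (1 - x ^ (m + 1)) / (1 + x ^ (m + 1)) := by
          rw [eq_div_iff hm1, hps]
        have hpm := hp m
        rw [e1, e2]
        have e3 : x ^ (m * (n + 1 + 1)) = x ^ (m * (n + 1)) * x ^ m := by ring
        have e4 : x ^ ((m + 1) * (n + 1)) = x ^ (m * (n + 1)) * x ^ (n + 1) := by ring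
        rw [e3, e4, pow_succ (-1 : ℂ) m]
        generalize x ^ (m * (n + 1)) = y, x ^ (n + 1) = z, x ^ (m + 1) = w, x ^ m = v at *
        field_simp
        ring
    have h := htel (n + 1)
    rw [Finset.sum_sub_distrib, ih, sub_eq_iff_eq_add] at h
    rw [Finset.sum_range_succ, h, Finset.sum_range_succ]
    have e1 : p (n + 1) = p n * (1 - x ^ (n + 1)) / (1 + x ^ (n + 1)) := by
      rw [eq_div_iff hn, hps]
    have hpn := hp n
    rw [div_self (hp _), e1]
    have e3 : x ^ ((n + 1) * (n + 1 + 1)) = x ^ ((n + 1) ^ 2) * x ^ (n + 1) := by ring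
    have e4 : x ^ ((n + 1) * (n + 1)) = x ^ ((n + 1) ^ 2) := by ring
    rw [e3, e4]
    generalize x ^ ((n + 1) ^ 2) = y, x ^ (n + 1) = z at *
    field_simp
    ring

theorem shanks_triangular_sum {x : ℂ} {p : ℕ → ℂ} (hx : ‖x‖ < 1) (hp : ∀ n, p n ≠ 0)
    (hps : ∀ n, p (n + 1) * (1 - x ^ (2 * n + 1)) = p n * (1 - x ^ (2 * n + 2))) (n : ℕ) :
    ∑ s ∈ Finset.range (n + 1), (p n / p s) * x ^ (s * (2 * n + 1)) =
      ∑ s ∈ Finset.range (2 * n + 1), x ^ (s * (s + 1) / 2) := by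
  induction n with
  | zero => simp [hp]
  | succ n ih =>
    have hn := one_sub_pow_ne_zero hx (n := 2 * n + 1) (by omega)
    have hn' := one_sub_pow_ne_zero hx (n := 2 * n + 2) (by omega)
    have e1 : p (n + 1) = p n * (1 - x ^ (2 * n + 2)) / (1 - x ^ (2 * n + 1)) := by
      rw [eq_div_iff hn, hps]
    have htel : ∀ m, ∑ s ∈ Finset.range m,
        ((p (n + 1) / p s) * x ^ (s * (2 * (n + 1) + 1)) -
         (p n / p s) * x ^ (s * (2 * n + 1))) =
        (p n / p m) * (1 - x ^ (2 * m)) * x ^ (m * (2 * n + 1)) / (1 - x ^ (2 * n + 1)) := by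
      intro m
      induction m with
      | zero => simp
      | succ m ihm =>
        rw [Finset.sum_range_succ, ihm]
        have hm1 := one_sub_pow_ne_zero hx (n := 2 * m + 1) (by omega)
        have hm1' := one_sub_pow_ne_zero hx (n := 2 * m + 2) (by omega)
        have e2 : p (m + 1) = p m * (1 - x ^ (2 * m + 2)) / (1 - x ^ (2 * m + 1)) := by
          rw [eq_div_iff hm1, hps]
        have hpm := hp m
        rw [e1, e2]
        have e3 : x ^ (m * (2 * (n + 1) + 1)) = x ^ (m * (2 * n + 1)) * x ^ (2 * m) := by ring
        have e4 : x ^ ((m + 1) * (2 * n + 1)) = x ^ (m * (2 * n + 1)) * x ^ (2 * n + 1) := by ring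
        have e5 : x ^ (2 * n + 2) = x ^ (2 * n + 1) * x := by ring
        have e6 : x ^ (2 * m + 2) = x ^ (2 * m) * x ^ 2 := by ring
        have e7 : x ^ (2 * m + 1) = x ^ (2 * m) * x := by ring
        rw [e6] at hm1'
        rw [e7] at hm1
        rw [e3, e4, mul_add 2 m 1, mul_one, e6, e7, e5]
        generalize x ^ (m * (2 * n + 1)) = y, x ^ (2 * n + 1) = z, x ^ (2 * m) = w at *
        field_simp
        ring
    have h := htel (n + 1)
    rw [Finset.sum_sub_distrib, ih, sub_eq_iff_eq_add] at h
    rw [Finset.sum_range_succ, h, show 2 * (n + 1) + 1 = 2 * n + 1 + 1 + 1 by ring,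
      Finset.sum_range_succ _ (2 * n + 1 + 1), Finset.sum_range_succ _ (2 * n + 1)]
    have hpn := hp n
    rw [div_self (hp _), e1]
    have d1 : (2 * n + 1) * (2 * n + 1 + 1) / 2 = (n + 1) * (2 * n + 1) := by
      rw [show (2 * n + 1) * (2 * n + 1 + 1) = (n + 1) * (2 * n + 1) * 2 by ring]; simp
    have d2 : (2 * n + 1 + 1) * (2 * n + 1 + 1 + 1) / 2 =
        (n + 1) * (2 * n + 1) + (2 * n + 2) := by
      rw [show (2 * n + 1 + 1) * (2 * n + 1 + 1 + 1) =
        ((n + 1) * (2 * n + 1) + (2 * n + 2)) * 2 by ring]; simp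
    have d3 : (n + 1) * (2 * n + 1 + 1 + 1) = (n + 1) * (2 * n + 1) + (2 * n + 2) := by ring
    have d4 : 2 * (n + 1) = 2 * n + 2 := by ring
    rw [d1, d2, d3, d4, pow_add x ((n + 1) * (2 * n + 1)) (2 * n + 2)]
    generalize x ^ ((n + 1) * (2 * n + 1)) = y, x ^ (2 * n + 1) = z, x ^ (2 * n + 2) = w at *
    field_simp
    ring

/-- Gauss' square theorem. -/
theorem hasSum_neg_zpow_sq {x : ℂ} (hx : ‖x‖ < 1) :
    HasSum (fun n : ℤ ↦ (-x) ^ (n ^ 2)) (eulerProd x ^ 2 / eulerProd (x ^ 2)) := by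
  have hx2 := norm_sq_lt_one hx
  set p : ℕ → ℂ := fun n ↦ eulerPartial x n ^ 2 / eulerPartial (x ^ 2) n with hpdef
  have hp : ∀ n, p n ≠ 0 := fun n ↦
    div_ne_zero (pow_ne_zero _ (eulerPartial_ne_zero hx n)) (eulerPartial_ne_zero hx2 n)
  have hlim : Tendsto p atTop (𝓝 (eulerProd x ^ 2 / eulerProd (x ^ 2))) :=
    ((tendsto_eulerPartial hx).pow 2).div (tendsto_eulerPartial hx2) (eulerProd_ne_zero hx2)
  have hp0 : p 0 = 1 := by simp [hpdef, eulerPartial]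
  have hps : ∀ n, p (n + 1) * (1 + x ^ (n + 1)) = p n * (1 - x ^ (n + 1)) := fun n ↦ by
    have h1 := eulerPartial_ne_zero hx2 n
    have h2 := one_add_pow_ne_zero hx (n := n + 1) (by omega)
    have h3 := one_sub_pow_ne_zero hx (n := n + 1) (by omega)
    simp only [hpdef, eulerPartial_succ]
    rw [show 1 - (x ^ 2) ^ (n + 1) = (1 - x ^ (n + 1)) * (1 + x ^ (n + 1)) by ring]
    field_simp
  obtain ⟨C, hC⟩ := norm_one_add_inv_le hx
  have hsh := tendsto_shanksSum hx (c := fun s ↦ 2 / (1 + x ^ s) * (-1) ^ s)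
    (a := fun n s ↦ s * (n + 1)) hlim
    (div_ne_zero (pow_ne_zero _ (eulerProd_ne_zero hx)) (eulerProd_ne_zero hx2)) hp0
    (by norm_num) (by simp) (fun n s hs ↦ by nlinarith [Nat.pos_of_ne_zero hs])
    ⟨C, fun s ↦ by simpa using hC s⟩
  have hpart : Tendsto (fun n ↦ 1 + 2 * ∑ s ∈ Finset.range n, (-x) ^ ((s + 1) ^ 2)) atTop
      (𝓝 (eulerProd x ^ 2 / eulerProd (x ^ 2))) := by
    refine hsh.congr fun n ↦ ?_
    rw [Finset.sum_congr rfl (fun s _ ↦ ?_), shanks_square_sum hx hp hp0 hps n]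
    · congr 2
      refine Finset.sum_congr rfl fun s _ ↦ ?_
      rw [neg_pow x]
      congr 1
      rw [pow_two, pow_mul]
      rcases Nat.even_or_odd (s + 1) with h | h
      · simp [h.neg_one_pow]
      · rw [h.neg_one_pow, h.neg_one_pow]
    · ring
  have hsum : Summable fun s : ℕ ↦ (-x) ^ ((s + 1) ^ 2) := by
    refine (summable_geometric_of_lt_one (norm_nonneg x) hx).of_norm_bounded fun s ↦ ?_
    rw [norm_pow, norm_neg]
    exact pow_le_pow_of_le_one (norm_nonneg _) hx.le (by nlinarith)
  have hval := tendsto_nhds_unique ((hsum.hasSum.tendsto_sum_nat.const_mul 2).const_add 1) hpart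
  have hpos : HasSum (fun n : ℕ ↦ (-x) ^ ((n : ℤ) ^ 2)) ((∑' s : ℕ, (-x) ^ ((s + 1) ^ 2)) + 1) := by
    rw [← hasSum_nat_add_iff' 1]
    simpa using! (mod_cast hsum.hasSum :
      HasSum (fun s : ℕ ↦ (-x) ^ (((s + 1 : ℕ) : ℤ) ^ 2)) (∑' s : ℕ, (-x) ^ ((s + 1) ^ 2)))
  have hneg : HasSum (fun n : ℕ ↦ (-x) ^ ((-(n : ℤ)) ^ 2))
      ((∑' s : ℕ, (-x) ^ ((s + 1) ^ 2)) + 1) := by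
    simpa only [neg_sq] using hpos
  have h := HasSum.of_nat_of_neg (f := fun n : ℤ ↦ (-x) ^ (n ^ 2)) hpos hneg
  have h0 : (-x) ^ ((0 : ℤ) ^ 2) = 1 := by simp
  rw [h0] at h
  rw [← hval]
  rwa [show ∀ T : ℂ, T + 1 + (T + 1) - 1 = 1 + 2 * T from fun T ↦ by ring] at h

/-- Gauss' triangular number theorem, in the variable `x ^ 2`. -/
theorem hasSum_zpow_sq_add {x : ℂ} (hx : ‖x‖ < 1) :
    HasSum (fun n : ℤ ↦ x ^ (n ^ 2 + n)) (2 * (eulerProd (x ^ 4) ^ 2 / eulerProd (x ^ 2))) := by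
  have hx2 := norm_sq_lt_one hx
  have hx4 := norm_sq_lt_one hx2
  set y := x ^ 2 with hy
  set p : ℕ → ℂ := fun n ↦ eulerPartial (y ^ 2) n ^ 2 / eulerPartial y (2 * n) with hpdef
  have hp : ∀ n, p n ≠ 0 := fun n ↦
    div_ne_zero (pow_ne_zero _ (eulerPartial_ne_zero hx4 n)) (eulerPartial_ne_zero hx2 _)
  have hlim : Tendsto p atTop (𝓝 (eulerProd (y ^ 2) ^ 2 / eulerProd y)) :=
    ((tendsto_eulerPartial hx4).pow 2).div
      ((tendsto_eulerPartial hx2).comp (tendsto_id.const_mul_atTop' two_pos))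
      (eulerProd_ne_zero hx2)
  have hp0 : p 0 = 1 := by simp [hpdef, eulerPartial]
  have hps : ∀ n, p (n + 1) * (1 - y ^ (2 * n + 1)) = p n * (1 - y ^ (2 * n + 2)) := fun n ↦ by
    have h1 := eulerPartial_ne_zero hx2 (2 * n)
    have h2 := one_sub_pow_ne_zero hx2 (n := 2 * n + 1) (by omega)
    have h3 := one_sub_pow_ne_zero hx2 (n := 2 * n + 2) (by omega)
    simp only [hpdef, mul_add 2 n 1, mul_one, eulerPartial_succ]
    rw [show 1 - (y ^ 2) ^ (n + 1) = 1 - y ^ (2 * n + 2) by ring]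
    rw [show 2 * n + 1 + 1 = 2 * n + 2 by ring]
    field_simp
  have hsh := tendsto_shanksSum hx2 (c := fun _ ↦ 1)
    (a := fun n s ↦ s * (2 * n + 1)) hlim
    (div_ne_zero (pow_ne_zero _ (eulerProd_ne_zero hx4)) (eulerProd_ne_zero hx2)) hp0
    rfl (by simp) (fun n s hs ↦ by nlinarith [Nat.pos_of_ne_zero hs]) ⟨1, by simp⟩
  have hpart : Tendsto (fun n ↦ ∑ s ∈ Finset.range (2 * n + 1), x ^ (s ^ 2 + s)) atTop
      (𝓝 (eulerProd (y ^ 2) ^ 2 / eulerProd y)) := by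
    refine hsh.congr fun n ↦ ?_
    simp only [one_mul]
    rw [shanks_triangular_sum hx2 hp hps n]
    refine Finset.sum_congr rfl fun s _ ↦ ?_
    rw [hy, ← pow_mul, Nat.mul_div_cancel' (Nat.even_mul_succ_self s).two_dvd]
    ring
  have hsum : Summable fun s : ℕ ↦ x ^ (s ^ 2 + s) := by
    refine (summable_geometric_of_lt_one (norm_nonneg x) hx).of_norm_bounded fun s ↦ ?_
    rw [norm_pow]
    exact pow_le_pow_of_le_one (norm_nonneg _) hx.le (by nlinarith)
  have hval := tendsto_nhds_unique (hsum.hasSum.tendsto_sum_nat.comp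
    (tendsto_atTop_mono (fun n ↦ by simp; omega) tendsto_id :
      Tendsto (fun n : ℕ ↦ 2 * n + 1) atTop atTop)) hpart
  have hpos : HasSum (fun n : ℕ ↦ x ^ ((n : ℤ) ^ 2 + n)) (∑' s : ℕ, x ^ (s ^ 2 + s)) :=
    mod_cast hsum.hasSum
  have hneg : HasSum (fun n : ℕ ↦ x ^ ((-((n : ℤ) + 1)) ^ 2 + -((n : ℤ) + 1)))
      (∑' s : ℕ, x ^ (s ^ 2 + s)) := by
    refine hpos.congr_fun fun n ↦ ?_
    congr 1
    ring
  have h := HasSum.of_nat_of_neg_add_one (f := fun n : ℤ ↦ x ^ (n ^ 2 + n)) hpos hneg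
  rwa [hval, ← two_mul, hy, ← pow_mul] at h

theorem hasSum_prod_mul {f g : ℤ → ℂ} {a b : ℂ} (hf : HasSum f a) (hg : HasSum g b) :
    HasSum (fun p : ℤ × ℤ ↦ f p.1 * g p.2) (a * b) :=
  hf.mul hg (summable_mul_of_summable_norm hf.summable.norm hg.summable.norm)

theorem theta_mul_theta_sub {x a a' b b' u v : ℂ} (hx0 : x ≠ 0)
    (ha : HasSum (fun n : ℤ ↦ x ^ (n ^ 2)) a) (hb : HasSum (fun n : ℤ ↦ (x ^ 3) ^ (n ^ 2)) b)
    (ha' : HasSum (fun n : ℤ ↦ (-x) ^ (n ^ 2)) a')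
    (hb' : HasSum (fun n : ℤ ↦ (-x ^ 3) ^ (n ^ 2)) b')
    (hu : HasSum (fun n : ℤ ↦ x ^ (n ^ 2 + n)) u)
    (hv : HasSum (fun n : ℤ ↦ (x ^ 3) ^ (n ^ 2 + n)) v) :
    a * b - a' * b' = x * (u * v) := by
  have hab := hasSum_prod_mul ha hb
  have hab' := hasSum_prod_mul ha' hb'
  have huv := (hasSum_prod_mul hu hv).mul_left x
  have h3 : ∀ k : ℤ, (x ^ 3) ^ k = x ^ (3 * k) := fun k ↦ by
    rw [zpow_mul]; norm_cast
  set F : ℤ × ℤ → ℂ := fun p ↦ x ^ (p.1 ^ 2 + 3 * p.2 ^ 2) with hF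
  set K : ℤ × ℤ → ℂ := fun p ↦ x ^ (p.1 ^ 2 + p.1 + 3 * (p.2 ^ 2 + p.2) + 1) with hK
  have hdiff : HasSum (fun p : ℤ × ℤ ↦ if Odd (p.1 + p.2) then 2 * F p else 0)
      (a * b - a' * b') := by
    refine (hab.sub hab').congr_fun fun p ↦ ?_
    have e : (-x) ^ (p.1 ^ 2) * (-x ^ 3) ^ (p.2 ^ 2) = (-1) ^ (p.1 + p.2) * F p := by
      rw [← neg_one_mul x, ← neg_one_mul (x ^ 3), mul_zpow, mul_zpow, h3]
      have s : ∀ n : ℤ, (-1 : ℂ) ^ (n ^ 2) = (-1) ^ n := fun n ↦ by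
        rcases Int.even_or_odd n with h | h
        · rw [h.neg_one_zpow, (h.pow_of_ne_zero two_ne_zero).neg_one_zpow]
        · rw [h.neg_one_zpow, h.pow.neg_one_zpow]
      rw [s, s, zpow_add₀ (by norm_num), hF]
      simp only [zpow_add₀ hx0]
      ring
    rw [e, h3, ← zpow_add₀ hx0]
    split_ifs with h
    · rw [h.neg_one_zpow]; ring
    · rw [(Int.not_odd_iff_even.mp h).neg_one_zpow]; ring
  have hprod : HasSum K (x * (u * v)) := by
    refine huv.congr_fun fun p ↦ ?_
    rw [h3, hK, ← zpow_add₀ hx0]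
    simp only [zpow_add_one₀ hx0]
    ring
  have hg : Function.Injective fun p : ℤ × ℤ ↦ (p.1 + p.2 + 1, p.1 - p.2) := by
    rintro ⟨s, t⟩ ⟨s', t'⟩ h
    simp only [Prod.mk.injEq] at h ⊢
    omega
  have hg₁ : Function.Injective fun p : ℤ × ℤ ↦ (2 * p.1 - p.2, -p.2 - 1) := by
    rintro ⟨s, t⟩ ⟨s', t'⟩ h
    simp only [Prod.mk.injEq] at h ⊢
    omega
  have hg₂ : Function.Injective fun p : ℤ × ℤ ↦ (2 * p.1 - p.2, p.2) := by
    rintro ⟨s, t⟩ ⟨s', t'⟩ h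
    simp only [Prod.mk.injEq] at h ⊢
    omega
  have hF' : ∑' p : ℤ × ℤ, 2 * F (p.1 + p.2 + 1, p.1 - p.2) = a * b - a' * b' := by
    rw [← hdiff.tsum_eq]
    refine (tsum_congr fun p ↦ ?_).trans (hg.tsum_eq ?_)
    · rw [if_pos ⟨p.1, by ring⟩]
    · rintro ⟨m, n⟩ hp
      have : Odd (m + n) := by_contra fun h ↦ hp (if_neg h)
      obtain ⟨k, hk⟩ := this
      exact ⟨(k, k - n), by simp; omega⟩
  have hK₁ : ∑' p : ℤ × ℤ, F (p.1 + p.2 + 1, p.1 - p.2) =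
      ∑' p : ℤ × ℤ, {p | Odd (p.1 + p.2)}.indicator K p := by
    refine (tsum_congr fun p ↦ ?_).trans (hg₁.tsum_eq ?_)
    · rw [Set.indicator_of_mem (show _ ∈ {p : ℤ × ℤ | Odd (p.1 + p.2)} from
        ⟨p.1 - p.2 - 1, by ring⟩)]
      simp only [hF, hK]
      ring_nf
    · rintro ⟨m, n⟩ hp
      have hodd : (m, n) ∈ {p : ℤ × ℤ | Odd (p.1 + p.2)} := Set.mem_of_indicator_ne_zero hp
      obtain ⟨k, hk : m + n = 2 * k + 1⟩ := hodd
      exact ⟨(k - n, -n - 1), by simp; omega⟩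
  have hK₂ : ∑' p : ℤ × ℤ, F (p.1 + p.2 + 1, p.1 - p.2) =
      ∑' p : ℤ × ℤ, {p | Odd (p.1 + p.2)}ᶜ.indicator K p := by
    refine (tsum_congr fun p ↦ ?_).trans (hg₂.tsum_eq ?_)
    · rw [Set.indicator_of_mem (show _ ∈ {p : ℤ × ℤ | Odd (p.1 + p.2)}ᶜ from
        Int.not_odd_iff_even.mpr ⟨p.1, by ring⟩)]
      simp only [hF, hK]
      ring_nf
    · rintro ⟨m, n⟩ hp
      obtain ⟨k, hk⟩ : Even (m + n) := Int.not_odd_iff_even.mp (Set.mem_of_indicator_ne_zero hp)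
      exact ⟨(k, n), by simp; omega⟩
  rw [← hF', tsum_mul_left, two_mul, ← hprod.tsum_eq]
  nth_rw 1 [hK₁]
  rw [hK₂, ← (hprod.summable.indicator _).tsum_add (hprod.summable.indicator _)]
  exact tsum_congr fun p ↦ by simp

theorem eulerProd_sq_mul_eulerProd_sq_sub {x : ℂ} (hx0 : x ≠ 0) (hx : ‖x‖ < 1) :
    eulerProd (-x) ^ 2 * eulerProd (-x ^ 3) ^ 2 - eulerProd x ^ 2 * eulerProd (x ^ 3) ^ 2 =
      4 * x * eulerProd (x ^ 4) ^ 2 * eulerProd (x ^ 12) ^ 2 := by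
  have hx3 : ‖x ^ 3‖ < 1 := by
    rw [norm_pow]; exact pow_lt_one₀ (norm_nonneg _) hx (by norm_num)
  have hxn : ‖-x‖ < 1 := by rwa [norm_neg]
  have hx3n : ‖-x ^ 3‖ < 1 := by rwa [norm_neg]
  have h := theta_mul_theta_sub hx0 (by simpa using hasSum_neg_zpow_sq hxn)
    (by simpa using hasSum_neg_zpow_sq hx3n) (hasSum_neg_zpow_sq hx) (hasSum_neg_zpow_sq hx3)
    (hasSum_zpow_sq_add hx) (hasSum_zpow_sq_add hx3)
  have h2 := eulerProd_ne_zero (norm_sq_lt_one hx)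
  have h6 := eulerProd_ne_zero (norm_sq_lt_one hx3)
  rw [← pow_mul, ← pow_mul] at h
  rw [← pow_mul] at h6
  norm_num at h h6
  field_simp at h
  linear_combination h

theorem isBigO_pow_comp_pow {m : ℕ} (hm : m ≠ 0) {f : ℂ → ℂ} {n : ℕ}
    (hf : f =O[𝓝 0] fun x ↦ x ^ n) : (fun x ↦ f (x ^ m)) =O[𝓝 0] fun x ↦ x ^ n := by
  have ht : Tendsto (fun x : ℂ ↦ x ^ m) (𝓝 0) (𝓝 0) := by
    have : Continuous fun x : ℂ ↦ x ^ m := by fun_prop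
    simpa [hm] using this.tendsto 0
  refine (hf.comp_tendsto ht).trans ?_
  refine .of_bound 1 ?_
  filter_upwards [Metric.ball_mem_nhds (0 : ℂ) one_pos] with x hx
  have hx : ‖x‖ < 1 := by simpa using hx
  simp only [Function.comp_apply, norm_pow, one_mul, ← pow_mul]
  exact pow_le_pow_of_le_one (norm_nonneg _) hx.le (Nat.le_mul_of_pos_left n (by omega))

theorem isBigO_mul_sub_mul {f g p q h : ℂ → ℂ} {a : ℂ} (hp : ContinuousAt p a)
    (hq : ContinuousAt q a) (hh : ContinuousAt h a)
    (hf : (fun x ↦ f x - p x) =O[𝓝 a] h) (hg : (fun x ↦ g x - q x) =O[𝓝 a] h) :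
    (fun x ↦ f x * g x - p x * q x) =O[𝓝 a] h := by
  have h1 := hf.mul (hq.isBigO_one ℂ)
  have h2 := (hp.isBigO_one ℂ).mul hg
  have h3 := hf.mul (hg.trans (hh.isBigO_one ℂ))
  simp only [mul_one, one_mul] at h1 h2 h3
  exact ((h1.add h2).add h3).congr_left fun x ↦ by ring

theorem isBigO_pow_sub_pow {f p h : ℂ → ℂ} {a : ℂ} (hp : ContinuousAt p a)
    (hh : ContinuousAt h a) (hf : (fun x ↦ f x - p x) =O[𝓝 a] h) (n : ℕ) :
    (fun x ↦ f x ^ n - p x ^ n) =O[𝓝 a] h := by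
  induction n with
  | zero => simpa using Asymptotics.isBigO_zero _ _
  | succ n ih => simpa only [pow_succ, Pi.pow_apply] using isBigO_mul_sub_mul (hp.pow n) hp hh ih hf

theorem isBigO_pow_of_eq_mul {f g : ℂ → ℂ} {n : ℕ} (hg : ContinuousAt g 0)
    (hfg : ∀ x, f x = x ^ n * g x) : f =O[𝓝 0] fun x ↦ x ^ n := by
  have := (Asymptotics.isBigO_refl (fun x : ℂ ↦ x ^ n) (𝓝 0)).mul (hg.isBigO_one ℂ)
  simp only [mul_one] at this
  exact this.congr_left fun x ↦ (hfg x).symm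

theorem eulerProd_isBigO : (fun x ↦ eulerProd x - (1 - x - x ^ 2 + x ^ 5)) =O[𝓝 0]
    fun x : ℂ ↦ x ^ 7 := by
  have hcont : Continuous fun x ↦ eulerPartial x 6 := by unfold eulerPartial; fun_prop
  have h1 : (fun x ↦ eulerProd x - eulerPartial x 6) =O[𝓝 0] fun x : ℂ ↦ x ^ 7 := by
    have h2 : (fun x ↦ eulerProd x - eulerPartial x 6) =O[𝓝 0]
        fun x : ℂ ↦ eulerPartial x 6 * x ^ 7 := by
      refine .of_bound 4 ?_
      filter_upwards [Metric.ball_mem_nhds (0 : ℂ) (by norm_num : (0 : ℝ) < 1 / 2)] with x hx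
      have hx : ‖x‖ < 1 / 2 := by simpa using hx
      rw [norm_mul, norm_pow, ← mul_assoc]
      exact norm_eulerProd_sub_eulerPartial_le hx.le 6
    have h3 := ((hcont.tendsto 0).isBigO_one ℂ).mul
      (Asymptotics.isBigO_refl (fun x : ℂ ↦ x ^ 7) (𝓝 0))
    simp only [one_mul] at h3
    exact h2.trans h3
  have h4 : (fun x ↦ eulerPartial x 6 - (1 - x - x ^ 2 + x ^ 5)) =O[𝓝 0] fun x : ℂ ↦ x ^ 7 := by
    refine isBigO_pow_of_eq_mul (g := fun x ↦ 2 - x ^ 2 - x ^ 3 - x ^ 4 - x ^ 5 + 2 * x ^ 7 + x ^ 9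
      - x ^ 12 - x ^ 13 + x ^ 14) (by fun_prop) fun x ↦ ?_
    simp only [eulerPartial, Finset.prod_range_succ, Finset.prod_range_zero]
    ring
  exact (h1.add h4).congr_left fun x ↦ by ring

/-- `x · δ` times `deltaDenom`, as a function of `x = q^{1/2}`. -/
noncomputable def deltaNum (x : ℂ) : ℂ :=
  2 * x * (eulerProd (x ^ 4) ^ 2 * eulerProd (x ^ 12) ^ 2) + eulerProd x ^ 2 * eulerProd (x ^ 3) ^ 2

/-- The common denominator of `f` and `γ`, without its leading power of `q`. -/
noncomputable def deltaDenom (x : ℂ) : ℂ := eulerProd (x ^ 2) ^ 4 * eulerProd (x ^ 6) ^ 4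

theorem eulerProd_pow_isBigO {m : ℕ} (hm : m ≠ 0) {p r : ℂ → ℂ} (hr : Continuous r)
    (hp : ∀ x, 1 - x ^ m - (x ^ m) ^ 2 + (x ^ m) ^ 5 - p x = x ^ 7 * r x) :
    (fun x ↦ eulerProd (x ^ m) - p x) =O[𝓝 0] fun x ↦ x ^ 7 :=
  ((isBigO_pow_comp_pow hm eulerProd_isBigO).add
    (isBigO_pow_of_eq_mul hr.continuousAt hp)).congr_left fun x ↦ by ring

theorem deltaDenom_isBigO : (fun x ↦ deltaDenom x -
    (1 - x ^ 2 - x ^ 4) ^ 4 * (1 - x ^ 6) ^ 4) =O[𝓝 0] fun x : ℂ ↦ x ^ 7 := by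
  have h2 := eulerProd_pow_isBigO (m := 2) (by norm_num) (p := fun x ↦ 1 - x ^ 2 - x ^ 4)
    (r := fun x ↦ x ^ 3) (by fun_prop) fun x ↦ by ring
  have h6 := eulerProd_pow_isBigO (m := 6) (by norm_num) (p := fun x ↦ 1 - x ^ 6)
    (r := fun x ↦ -x ^ 5 + x ^ 23) (by fun_prop) fun x ↦ by ring
  exact isBigO_mul_sub_mul (by fun_prop) (by fun_prop) (by fun_prop)
    (isBigO_pow_sub_pow (by fun_prop) (by fun_prop) h2 4)
    (isBigO_pow_sub_pow (by fun_prop) (by fun_prop) h6 4)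

theorem deltaNum_isBigO : (fun x ↦ deltaNum x - (2 * x * ((1 - x ^ 4) ^ 2 * 1 ^ 2) +
    (1 - x - x ^ 2 + x ^ 5) ^ 2 * (1 - x ^ 3 - x ^ 6) ^ 2)) =O[𝓝 0] fun x : ℂ ↦ x ^ 7 := by
  have h3 := eulerProd_pow_isBigO (m := 3) (by norm_num) (p := fun x ↦ 1 - x ^ 3 - x ^ 6)
    (r := fun x ↦ x ^ 8) (by fun_prop) fun x ↦ by ring
  have h4 := eulerProd_pow_isBigO (m := 4) (by norm_num) (p := fun x ↦ 1 - x ^ 4)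
    (r := fun x ↦ -x + x ^ 13) (by fun_prop) fun x ↦ by ring
  have h12 := eulerProd_pow_isBigO (m := 12) (by norm_num) (p := fun x ↦ 1)
    (r := fun x ↦ -x ^ 5 - x ^ 17 + x ^ 53) (by fun_prop) fun x ↦ by ring
  have ha := isBigO_mul_sub_mul (by fun_prop) (by fun_prop) (by fun_prop)
    (isBigO_pow_sub_pow (by fun_prop) (by fun_prop) h4 2)
    (isBigO_pow_sub_pow (by fun_prop) (by fun_prop) h12 2)
  have hb := isBigO_mul_sub_mul (by fun_prop) (by fun_prop) (by fun_prop)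
    (isBigO_pow_sub_pow (by fun_prop) (by fun_prop) eulerProd_isBigO 2)
    (isBigO_pow_sub_pow (by fun_prop) (by fun_prop) h3 2)
  have hc := isBigO_mul_sub_mul (f := fun x ↦ 2 * x) (p := fun x ↦ 2 * x)
    (by fun_prop) (by fun_prop) (by fun_prop)
    (by simpa using Asymptotics.isBigO_zero _ _) ha
  exact (hc.add hb).congr_left fun x ↦ by simp only [deltaNum]; ring

theorem deltaNum_sub_isBigO : (fun x ↦ deltaNum x -
    (1 + 3 * x ^ 2 + 15 * x ^ 4 + 43 * x ^ 6) * deltaDenom x) =O[𝓝 0] fun x : ℂ ↦ x ^ 7 := by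
  have hd := isBigO_mul_sub_mul (f := fun x ↦ 1 + 3 * x ^ 2 + 15 * x ^ 4 + 43 * x ^ 6)
    (p := fun x ↦ 1 + 3 * x ^ 2 + 15 * x ^ 4 + 43 * x ^ 6)
    (by fun_prop) (by fun_prop) (by fun_prop)
    (by simpa using Asymptotics.isBigO_zero _ _) deltaDenom_isBigO
  have hpoly : (fun x : ℂ ↦ (2 * x * ((1 - x ^ 4) ^ 2 * 1 ^ 2) +
      (1 - x - x ^ 2 + x ^ 5) ^ 2 * (1 - x ^ 3 - x ^ 6) ^ 2) -
      (1 + 3 * x ^ 2 + 15 * x ^ 4 + 43 * x ^ 6) *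
        ((1 - x ^ 2 - x ^ 4) ^ 4 * (1 - x ^ 6) ^ 4)) =O[𝓝 0] fun x ↦ x ^ 7 :=
    isBigO_pow_of_eq_mul (g := fun x ↦
        -2 + 116 * x + 6 * x ^ 2 - 163 * x ^ 3 - 4 * x ^ 4 - 258 * x ^ 5 - 158 * x ^ 7 - 2 *
        x ^ 8 + 999 * x ^ 9 + 2 * x ^ 10 + 859 * x ^ 11 - 753 * x ^ 13 - 2324 * x ^ 15 - 899
        * x ^ 17 + 2207 * x ^ 19 + 2705 * x ^ 21 + 97 * x ^ 23 - 2299 * x ^ 25 - 1645 * x ^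
        27 + 349 * x ^ 29 + 1073 * x ^ 31 + 473 * x ^ 33 - 149 * x ^ 35 - 187 * x ^ 37 - 43 *
        x ^ 39) (by fun_prop) fun x ↦ by ring
  exact ((deltaNum_isBigO.add hpoly).sub hd).congr_left fun x ↦ by ring

theorem tendsto_of_sub_isBigO {f p : ℂ → ℂ} {n : ℕ} (hn : n ≠ 0) (hp : ContinuousAt p 0)
    (hf : (fun x ↦ f x - p x) =O[𝓝 0] fun x ↦ x ^ n) : Tendsto f (𝓝 0) (𝓝 (p 0)) := by
  have h0 : Tendsto (fun x : ℂ ↦ x ^ n) (𝓝 0) (𝓝 0) := by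
    have : Continuous fun x : ℂ ↦ x ^ n := by fun_prop
    simpa [hn] using this.tendsto 0
  simpa using (hf.trans_tendsto h0).add hp.tendsto

theorem deltaDenom_ne_zero {x : ℂ} (hx : ‖x‖ < 1) : deltaDenom x ≠ 0 := by
  have h : ∀ m : ℕ, m ≠ 0 → eulerProd (x ^ m) ≠ 0 := fun m hm ↦
    eulerProd_ne_zero (by rw [norm_pow]; exact pow_lt_one₀ (norm_nonneg _) hx hm)
  exact mul_ne_zero (pow_ne_zero _ (h 2 (by norm_num))) (pow_ne_zero _ (h 6 (by norm_num)))

theorem deltaNum_neg {x : ℂ} (hx0 : x ≠ 0) (hx : ‖x‖ < 1) : deltaNum (-x) = deltaNum x := by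
  have h := eulerProd_sq_mul_eulerProd_sq_sub hx0 hx
  simp only [deltaNum, Even.neg_pow (by decide : Even 4), Even.neg_pow (by decide : Even 12),
    Odd.neg_pow (by decide : Odd 3)]
  linear_combination h

theorem deltaDenom_neg (x : ℂ) : deltaDenom (-x) = deltaDenom x := by
  simp only [deltaDenom, Even.neg_pow (by decide : Even 2), Even.neg_pow (by decide : Even 6)]

theorem dedekindEta_eq {w t τ : ℂ} {n : ℕ} (hw : w = exp (Real.pi * I * τ / 24))
    (ht : 2 * t = n * τ) :
    dedekindEta t = w ^ n * eulerProd (exp (Real.pi * I * τ) ^ n) := by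
  unfold dedekindEta eulerProd
  congr 1
  · rw [hw, ← exp_nat_mul]
    congr 1
    linear_combination (Real.pi * I / 24) * ht
  · refine tprod_congr fun k ↦ ?_
    rw [← exp_nat_mul, ← exp_nat_mul]
    congr 2
    push_cast
    linear_combination (Real.pi * I * (k + 1)) * ht

theorem fSuper3_add_gammaSuper3 {τ : ℂ} (hτ : 0 < τ.im) :
    fSuper3 τ + gammaSuper3 τ = deltaNum (exp (Real.pi * I * τ)) /
      (exp (Real.pi * I * τ) * deltaDenom (exp (Real.pi * I * τ))) := by
  obtain ⟨w, hw⟩ : ∃ w, w = exp (Real.pi * I * τ / 24) := ⟨_, rfl⟩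
  have hx : exp (Real.pi * I * τ) = w ^ 24 := by
    rw [hw, ← exp_nat_mul]; congr 1; push_cast; ring
  have hx1 : ‖exp (Real.pi * I * τ)‖ < 1 := by
    rw [norm_exp, Real.exp_lt_one_iff]
    simp
    positivity
  have hD := deltaDenom_ne_zero hx1
  have hw0 : w ≠ 0 := hw ▸ exp_ne_zero _
  unfold fSuper3 gammaSuper3
  rw [dedekindEta_eq (t := 6 * τ) (n := 12) hw (by push_cast; ring),
    dedekindEta_eq (t := 2 * τ) (n := 4) hw (by push_cast; ring),
    dedekindEta_eq (t := 3 * τ) (n := 6) hw (by push_cast; ring),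
    dedekindEta_eq (t := τ) (n := 2) hw (by push_cast; ring),
    dedekindEta_eq (t := 3 * τ / 2) (n := 3) hw (by push_cast; ring),
    dedekindEta_eq (t := τ / 2) (n := 1) hw (by push_cast; ring)]
  simp only [deltaDenom, deltaNum, pow_one] at hD ⊢
  generalize exp (Real.pi * I * τ) = x at *
  obtain ⟨h2, h6⟩ := mul_ne_zero_iff.mp hD
  replace h2 := (pow_ne_zero_iff (by norm_num)).mp h2
  replace h6 := (pow_ne_zero_iff (by norm_num)).mp h6
  generalize eulerProd (x ^ 2) = e2, eulerProd (x ^ 6) = e6, eulerProd (x ^ 12) = e12,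
    eulerProd (x ^ 4) = e4, eulerProd (x ^ 3) = e3, eulerProd x = e1 at *
  subst hx
  field_simp

theorem exists_exp_pi_I_mul_eq {x : ℂ} (hx0 : x ≠ 0) (hx : ‖x‖ < 1) :
    ∃ τ : ℂ, 0 < τ.im ∧ exp (Real.pi * I * τ) = x := by
  have hpi : (Real.pi : ℂ) ≠ 0 := by exact_mod_cast Real.pi_ne_zero
  refine ⟨-I * log x * (Real.pi⁻¹ : ℝ), ?_, ?_⟩
  · rw [im_mul_ofReal]
    have := Real.log_neg (norm_pos_iff.mpr hx0) hx
    have hp := Real.pi_pos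
    simp [log_re]
    nlinarith [inv_pos.mpr hp]
  · have : Real.pi * I * (-I * log x * (Real.pi⁻¹ : ℝ)) = log x := by
      push_cast
      field_simp
      simp
    rw [this, exp_log hx0]

/-- The expansion of `δ = f + γ` in powers of `q^{1/2} = e^{πiτ}` contains only half-integral
powers of `q`: all coefficients of integral powers of `q` vanish, and
`δ = q^{-1/2} + 3q^{1/2} + 15q^{3/2} + 43q^{5/2} + ⋯`. -/
theorem stmt8 (d : ℤ → ℂ)
    (h : ∀ τ : ℂ, 0 < τ.im →
      fSuper3 τ + gammaSuper3 τ =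
        ∑' k : ℤ, d k * Complex.exp (Real.pi * Complex.I * τ) ^ k) :
    (∀ n : ℤ, d (2 * n) = 0) ∧ d (-1) = 1 ∧ d 1 = 3 ∧ d 3 = 15 ∧ d 5 = 43 := by
  have hnum : Tendsto deltaNum (𝓝 0) (𝓝 1) := by
    simpa using tendsto_of_sub_isBigO (by norm_num) (by fun_prop) deltaNum_isBigO
  have hden : Tendsto deltaDenom (𝓝 0) (𝓝 1) := by
    simpa using tendsto_of_sub_isBigO (by norm_num) (by fun_prop) deltaDenom_isBigO
  have hR : (fun x ↦ (deltaNum x - (1 + 3 * x ^ 2 + 15 * x ^ 4 + 43 * x ^ 6) * deltaDenom x) *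
      (deltaDenom x)⁻¹) =O[𝓝 0] fun x : ℂ ↦ x ^ 7 := by
    simpa using deltaNum_sub_isBigO.mul ((hden.inv₀ one_ne_zero).isBigO_one ℂ)
  obtain ⟨C, hC⟩ := hR.bound
  obtain ⟨ε, hε, hball⟩ := Metric.eventually_nhds_iff_ball.mp
    ((hnum.eventually_ne one_ne_zero).and (hC.and (Metric.ball_mem_nhds 0 one_pos)))
  simp only [mem_ball_zero_iff, dist_zero_right] at hball
  set G : ℂ → ℂ := fun x ↦ deltaNum x / (x * deltaDenom x) with hG
  have hsum : ∀ x : ℂ, 0 < ‖x‖ → ‖x‖ < ε → HasSum (fun k : ℤ ↦ d k * x ^ k) (G x) := by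
    intro x hx0 hxε
    obtain ⟨hN, -, hx1⟩ := hball x hxε
    have hx0 := norm_pos_iff.mp hx0
    obtain ⟨τ, hτ, hτx⟩ := exists_exp_pi_I_mul_eq hx0 hx1
    have hval := h τ hτ
    rw [fSuper3_add_gammaSuper3 hτ, hτx] at hval
    have hne : G x ≠ 0 := div_ne_zero hN (mul_ne_zero hx0 (deltaDenom_ne_zero hx1))
    have hs : Summable fun k : ℤ ↦ d k * x ^ k := by
      by_contra hns
      exact hne (hval.trans (tsum_eq_zero_of_not_summable hns))
    exact (show G x = _ from hval) ▸ hs.hasSum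
  refine ⟨fun n ↦ ?_, ?_⟩
  · have hodd : ∀ x : ℂ, 0 < ‖x‖ → ‖x‖ < ε →
        HasSum (fun k : ℤ ↦ d k * (1 + (-1) ^ k) * x ^ k) 0 := by
      intro x hx0 hxε
      have h1 := (hsum x hx0 hxε).add (hsum (-x) (by rwa [norm_neg]) (by rwa [norm_neg]))
      have h2 : G x + G (-x) = 0 := by
        simp only [hG]
        rw [deltaNum_neg (norm_pos_iff.mp hx0) (hball x hxε).2.2, deltaDenom_neg, neg_mul, div_neg,
          add_neg_cancel]
      rw [h2] at h1
      refine h1.congr_fun fun k ↦ ?_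
      rw [← neg_one_mul x, mul_zpow]
      ring
    have h0 := laurentCoeff_eq_zero (C := 0) (N := (2 * n).toNat + 1) hε hodd (by simp)
      (j := 2 * n) (by omega)
    rw [(even_two_mul n).neg_one_zpow] at h0
    simpa using h0
  · set p : ℤ → ℂ := fun k ↦
      if k = -1 then 1 else if k = 1 then 3 else if k = 3 then 15 else if k = 5 then 43 else 0
      with hp
    have hpsum : ∀ x : ℂ, HasSum (fun k : ℤ ↦ p k * x ^ k)
        (x⁻¹ + 3 * x + 15 * x ^ 3 + 43 * x ^ 5) := by
      intro x
      have : HasSum (fun k : ℤ ↦ p k * x ^ k) (∑ k ∈ {-1, 1, 3, 5}, p k * x ^ k) :=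
        hasSum_sum_of_ne_finset_zero fun k hk ↦ by
          simp only [Finset.mem_insert, Finset.mem_singleton, not_or] at hk
          simp [hp, hk]
      convert this using 1
      simp [hp]
      norm_cast
      ring
    have key : ∀ j : ℤ, j < 6 → d j = p j := fun j hj ↦ by
      refine sub_eq_zero.mp (laurentCoeff_eq_zero (c := fun k ↦ d k - p k) (C := C) (N := 6)
        (g := fun x ↦ G x - (x⁻¹ + 3 * x + 15 * x ^ 3 + 43 * x ^ 5)) hε ?_ ?_ (by simpa using hj))
      · intro x hx0 hxε
        simpa only [sub_mul] using (hsum x hx0 hxε).sub (hpsum x)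
      · intro x hx0 hxε
        obtain ⟨-, hb, hx1⟩ := hball x hxε
        have hx := norm_pos_iff.mp hx0
        have hD := deltaDenom_ne_zero hx1
        have e : (deltaNum x - (1 + 3 * x ^ 2 + 15 * x ^ 4 + 43 * x ^ 6) * deltaDenom x) *
            (deltaDenom x)⁻¹ = x * (G x - (x⁻¹ + 3 * x + 15 * x ^ 3 + 43 * x ^ 5)) := by
          simp only [hG]
          field_simp
        rw [e, norm_mul, norm_pow] at hb
        refine le_of_mul_le_mul_left ?_ hx0
        calc _ ≤ _ := hb
          _ = _ := by ring
    simp [key, hp]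
end
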